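/- arXiv:2010.02618 — 9 statements merged into one kernel-verified Lean document; each statement's English description precedes it below -/
import Mathlib

section
/- Let L = L(n₁,n₂,n₃) ⊂ ℕ³ and let f : L → L. Suppose (d, b) is a down set witness, i.e. d, b ∈ L satisfy d₃ = b₃, d₃ ≤ f(d)₃, b₃ ≤ f(b)₃, and there exist distinct i, j ∈ {1,2} with d_i = b_i, d_j ≤ b_j, d_j ≤ f(d)_j, and f(b)_j ≤ b_j. Then at least one of the following exists: (1) a point c with d ⪯ c ⪯ b and c ⪯ f(c); (2) two points x, y with d ⪯ x ⪯ y ⪯ b and ¬(f(x) ⪯ f(y)); (3) a point c with d ⪯ c ⪯ b, f(c)₁ ≤ c₁, and f(c)₂ ≤ c₂. -/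
/-- A function on a nonempty interval of naturals that is monotone there and maps the endpoints
inwards has a fixed point in the interval. -/
theorem MonotoneOn.exists_nat_fixedPoint {g : ℕ → ℕ} {a b : ℕ} (hg : MonotoneOn g (Set.Icc a b))
    (hab : a ≤ b) (ha : a ≤ g a) (hb : g b ≤ b) : ∃ t, a ≤ t ∧ t ≤ b ∧ g t = t := by
  set t := Nat.findGreatest (fun s => s ≤ g s) b
  have hat : a ≤ t := Nat.le_findGreatest hab ha
  have htb : t ≤ b := Nat.findGreatest_le b
  have htg : t ≤ g t := Nat.findGreatest_spec (P := fun s => s ≤ g s) hab ha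
  have hgb : g t ≤ b := (hg ⟨hat, htb⟩ ⟨hab, le_rfl⟩ htb).trans hb
  have hgg : g t ≤ g (g t) := hg ⟨hat, htb⟩ ⟨hat.trans htg, hgb⟩ htg
  exact ⟨t, hat, htb, le_antisymm (Nat.le_findGreatest hgb hgg) htg⟩


/-- **Lemma (down set witnesses).**
If `(d, b)` is a down set witness in a three-dimensional Tarski instance, then
between `d` and `b` there is either (1) a point of the up set of `f`, or
(2) a pair of points violating order preservation of `f`, or (3) a point of the
down set of the restriction `f_s` of `f` to the slice fixing dimension 3. -/
theorem down_set_witness (n : Fin 3 → ℕ)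
    (f : (Fin 3 → ℕ) → (Fin 3 → ℕ))
    (hf : ∀ x, (∀ m, 1 ≤ x m ∧ x m ≤ n m) → ∀ m, 1 ≤ f x m ∧ f x m ≤ n m)
    (d b : Fin 3 → ℕ)
    (hd : ∀ m, 1 ≤ d m ∧ d m ≤ n m) (hb : ∀ m, 1 ≤ b m ∧ b m ≤ n m)
    (h3 : d 2 = b 2) (hd3 : d 2 ≤ f d 2) (hb3 : b 2 ≤ f b 2)
    (hw : ∃ i j : Fin 3, (i = 0 ∨ i = 1) ∧ (j = 0 ∨ j = 1) ∧ i ≠ j ∧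
      d i = b i ∧ d j ≤ b j ∧ d j ≤ f d j ∧ f b j ≤ b j) :
    (∃ c, (∀ m, d m ≤ c m) ∧ (∀ m, c m ≤ b m) ∧ (∀ m, c m ≤ f c m)) ∨
    (∃ x y, (∀ m, d m ≤ x m) ∧ (∀ m, x m ≤ y m) ∧ (∀ m, y m ≤ b m) ∧
      ¬ (∀ m, f x m ≤ f y m)) ∨
    (∃ c, (∀ m, d m ≤ c m) ∧ (∀ m, c m ≤ b m) ∧ f c 0 ≤ c 0 ∧ f c 1 ≤ c 1) := by
  by_cases hv : ∃ x y, (∀ m, d m ≤ x m) ∧ (∀ m, x m ≤ y m) ∧ (∀ m, y m ≤ b m) ∧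
      ¬ (∀ m, f x m ≤ f y m)
  · exact Or.inr (Or.inl hv)
  have mono : ∀ x y, (∀ m, d m ≤ x m) → (∀ m, x m ≤ y m) → (∀ m, y m ≤ b m) →
      ∀ m, f x m ≤ f y m := by
    intro x y hx hxy hy
    by_contra h
    exact hv ⟨x, y, hx, hxy, hy, h⟩
  obtain ⟨i, j, hi, hj, hij, hdbi, hdbj, hdj, hbj⟩ := hw
  have hcases : ∀ m, m = i ∨ m = j ∨ m = 2 := by omega
  have hj2 : (2 : Fin 3) ≠ j := by omega
  have hdb : ∀ m, d m ≤ b m := by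
    intro m
    rcases hcases m with rfl | rfl | rfl
    exacts [hdbi.le, hdbj, h3.le]
  have hlow : ∀ t, d j ≤ t → ∀ m, d m ≤ Function.update d j t m :=
    fun t ht => le_update_self_iff.2 ht
  have hupp : ∀ t, t ≤ b j → ∀ m, Function.update d j t m ≤ b m :=
    fun t ht => update_le_iff.2 ⟨ht, fun m _ => hdb m⟩
  have hupd : Function.update d j (b j) = b := by
    ext m
    rcases hcases m with rfl | rfl | rfl
    · rw [Function.update_of_ne hij, hdbi]
    · rw [Function.update_self]
    · rw [Function.update_of_ne hj2, h3]
  have hg : MonotoneOn (fun t => f (Function.update d j t) j) (Set.Icc (d j) (b j)) :=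
    fun s hs t ht hst => mono _ _ (hlow s hs.1) (Function.update_mono hst) (hupp t ht.2) j
  obtain ⟨t, hat, htb, hfix⟩ := hg.exists_nat_fixedPoint hdbj
    (by simpa using hdj) (by simpa [hupd] using hbj)
  set c := Function.update d j t with hc
  have hcj : f c j = c j := by rw [hfix, hc, Function.update_self]
  have hc2 : c 2 ≤ f c 2 := by
    rw [hc, Function.update_of_ne hj2]
    exact hd3.trans (mono d c (fun _ => le_rfl) (hlow t hat) (hupp t htb) 2)
  rcases le_total (c i) (f c i) with h | h
  · refine Or.inl ⟨c, hlow t hat, hupp t htb, fun m => ?_⟩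
    rcases hcases m with rfl | rfl | rfl
    exacts [h, hcj.ge, hc2]
  · refine Or.inr (Or.inr ⟨c, hlow t hat, hupp t htb, ?_⟩)
    rcases hi with rfl | rfl <;> rcases hj with rfl | rfl
    exacts [absurd rfl hij, ⟨h, hcj.le⟩, ⟨hcj.le, h⟩, absurd rfl hij]
end

section
/- Let L = L(n₁,n₂,n₃) ⊂ ℕ³ and let f : L → L. Suppose (a, u) is an up set witness, i.e. a, u ∈ L satisfy a₃ = u₃, a₃ ≥ f(a)₃, u₃ ≥ f(u)₃, and there exist distinct i, j ∈ {1,2} with a_i = u_i, u_j ≥ a_j, u_j ≥ f(u)_j, and f(a)_j ≥ a_j. Then at least one of the following exists: (1) a point c with a ⪯ c ⪯ u and f(c) ⪯ c; (2) two points x, y with a ⪯ x ⪯ y ⪯ u and ¬(f(x) ⪯ f(y)); (3) a point c with a ⪯ c ⪯ u, c₁ ≤ f(c)₁, and c₂ ≤ f(c)₂. -/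
/-- A monotone map on an integer interval `[p, q]` with `p ≤ g p` and `g q ≤ q` has a fixed point. -/
lemma exists_fixedPoint_of_monotoneOn_Icc {g : ℕ → ℕ} {p q : ℕ} (hpq : p ≤ q)
    (hg : MonotoneOn g (Set.Icc p q)) (hp : p ≤ g p) (hq : g q ≤ q) :
    ∃ t ∈ Set.Icc p q, g t = t := by
  induction q, hpq using Nat.le_induction with
  | base => exact ⟨p, ⟨le_rfl, le_rfl⟩, le_antisymm hq hp⟩
  | succ q hpq ih =>
    by_cases h : g q ≤ q
    · obtain ⟨t, ht, hgt⟩ := ih (hg.mono (Set.Icc_subset_Icc_right q.le_succ)) h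
      exact ⟨t, ⟨ht.1, ht.2.trans q.le_succ⟩, hgt⟩
    · have : g q ≤ g (q + 1) := hg ⟨hpq, q.le_succ⟩ ⟨hpq.trans q.le_succ, le_rfl⟩ q.le_succ
      exact ⟨q + 1, ⟨hpq.trans q.le_succ, le_rfl⟩, by omega⟩

/-- **Lemma (up set witnesses).**
If `(a, u)` is an up set witness in a three-dimensional Tarski instance, then
between `a` and `u` there is either (1) a point of the down set of `f`, or
(2) a pair of points violating order preservation of `f`, or (3) a point of the
up set of the restriction `f_s` of `f` to the slice fixing dimension 3. -/
theorem up_set_witness (n : Fin 3 → ℕ)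
    (f : (Fin 3 → ℕ) → (Fin 3 → ℕ))
    (hf : ∀ x, (∀ m, 1 ≤ x m ∧ x m ≤ n m) → ∀ m, 1 ≤ f x m ∧ f x m ≤ n m)
    (a u : Fin 3 → ℕ)
    (ha : ∀ m, 1 ≤ a m ∧ a m ≤ n m) (hu : ∀ m, 1 ≤ u m ∧ u m ≤ n m)
    (h3 : a 2 = u 2) (ha3 : f a 2 ≤ a 2) (hu3 : f u 2 ≤ u 2)
    (hw : ∃ i j : Fin 3, (i = 0 ∨ i = 1) ∧ (j = 0 ∨ j = 1) ∧ i ≠ j ∧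
      a i = u i ∧ a j ≤ u j ∧ f u j ≤ u j ∧ a j ≤ f a j) :
    (∃ c, (∀ m, a m ≤ c m) ∧ (∀ m, c m ≤ u m) ∧ (∀ m, f c m ≤ c m)) ∨
    (∃ x y, (∀ m, a m ≤ x m) ∧ (∀ m, x m ≤ y m) ∧ (∀ m, y m ≤ u m) ∧
      ¬ (∀ m, f x m ≤ f y m)) ∨
    (∃ c, (∀ m, a m ≤ c m) ∧ (∀ m, c m ≤ u m) ∧ c 0 ≤ f c 0 ∧ c 1 ≤ f c 1) := by
  obtain ⟨i, j, hi, hj, hij, hau, hle, huj, haj⟩ := hw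
  by_cases hviol : ∃ x y, (∀ m, a m ≤ x m) ∧ (∀ m, x m ≤ y m) ∧ (∀ m, y m ≤ u m) ∧
      ¬ (∀ m, f x m ≤ f y m)
  · exact Or.inr (Or.inl hviol)
  have hmono : ∀ x y, a ≤ x → x ≤ y → y ≤ u → f x ≤ f y := fun x y hx hxy hy => by
    by_contra h
    exact hviol ⟨x, y, hx, hxy, hy, h⟩
  have hu_eq : Function.update a j (u j) = u := by
    ext m
    by_cases hm : m = j
    · simp [hm]
    · rw [Function.update_of_ne hm]
      have : m = i ∨ m = 2 := by omega
      rcases this with rfl | rfl <;> assumption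
  have hlow : ∀ t, a j ≤ t → a ≤ Function.update a j t := fun t ht =>
    le_update_iff.2 ⟨ht, fun _ _ => le_rfl⟩
  have hstep : ∀ s t, s ≤ t → Function.update a j s ≤ Function.update a j t := fun s t hst =>
    update_le_update_iff.2 ⟨hst, fun _ _ => le_rfl⟩
  have hupp : ∀ t, t ≤ u j → Function.update a j t ≤ u := fun t ht =>
    (hstep t (u j) ht).trans hu_eq.le
  obtain ⟨t, ⟨hat, htu⟩, hfix⟩ := exists_fixedPoint_of_monotoneOn_Icc
    (g := fun t => f (Function.update a j t) j) hle
    (fun s hs t ht hst => hmono _ _ (hlow s hs.1) (hstep s t hst) (hupp t ht.2) j)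
    (by simpa using haj) (by simpa [hu_eq] using huj)
  have hcu := hupp t htu
  have hac := hlow t hat
  have hcj : Function.update a j t j = t := Function.update_self ..
  have hc2 : Function.update a j t 2 = u 2 := by
    rw [Function.update_of_ne (by omega), h3]
  have hf2 := hmono _ u hac hcu le_rfl 2
  generalize Function.update a j t = c at *
  rcases le_total (f c i) (c i) with h | h
  · refine Or.inl ⟨c, hac, hcu, fun m => ?_⟩
    have : m = i ∨ m = j ∨ m = 2 := by omega
    rcases this with rfl | rfl | rfl
    · exact h
    · exact (hfix.trans hcj.symm).le
    · exact hf2.trans (hu3.trans hc2.ge)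
  · refine Or.inr (Or.inr ⟨c, hac, hcu, ?_⟩)
    have hj' : c j ≤ f c j := (hcj.trans hfix.symm).le
    rcases hi with rfl | rfl <;> rcases hj with rfl | rfl
    · exact absurd rfl hij
    · exact ⟨h, hj'⟩
    · exact ⟨hj', h⟩
    · exact absurd rfl hij
end

section
/- Let L = L(n₁,n₂,n₃) ⊂ ℕ³, let f : L → L, and let a, b ∈ L with a ⪯ b and a₃ = b₃. Suppose the inner algorithm invariant holds for L_{a,b}: (i) either a₁ ≤ f(a)₁ and a₂ ≤ f(a)₂, or there is a point u with u ⪯ b such that (a, u) is an up set witness; (ii) either f(b)₁ ≤ b₁ and f(b)₂ ≤ b₂, or there is a point d with a ⪯ d such that (d, b) is a down set witness; and (iii) if both witnesses are present then u ⪯ d. Then at least one of the following exists: a point x with a ⪯ x ⪯ b such that x ⪯ f(x) or f(x) ⪯ x; or two points x, y with a ⪯ x ⪯ y ⪯ b and ¬(f(x) ⪯ f(y)). -/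
/-- A down set witness for the slice fixing dimension 3: a pair `(d, b)` of points
of the slice with `d₃ ≤ f(d)₃` and `b₃ ≤ f(b)₃`, such that for some distinct
`i, j ∈ {1,2}` we have `d_i = b_i`, `d_j ≤ b_j`, `d_j ≤ f(d)_j`, and `f(b)_j ≤ b_j`. -/
def DownSetWitness (f : (Fin 3 → ℕ) → (Fin 3 → ℕ)) (d b : Fin 3 → ℕ) : Prop :=
  d 2 = b 2 ∧ d 2 ≤ f d 2 ∧ b 2 ≤ f b 2 ∧
  ∃ i j : Fin 3, (i = 0 ∨ i = 1) ∧ (j = 0 ∨ j = 1) ∧ i ≠ j ∧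
    d i = b i ∧ d j ≤ b j ∧ d j ≤ f d j ∧ f b j ≤ b j

/-- An up set witness for the slice fixing dimension 3: a pair `(a, u)` of points
of the slice with `a₃ ≥ f(a)₃` and `u₃ ≥ f(u)₃`, such that for some distinct
`i, j ∈ {1,2}` we have `a_i = u_i`, `u_j ≥ a_j`, `u_j ≥ f(u)_j`, and `f(a)_j ≥ a_j`. -/
def UpSetWitness (f : (Fin 3 → ℕ) → (Fin 3 → ℕ)) (a u : Fin 3 → ℕ) : Prop :=
  a 2 = u 2 ∧ f a 2 ≤ a 2 ∧ f u 2 ≤ u 2 ∧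
  ∃ i j : Fin 3, (i = 0 ∨ i = 1) ∧ (j = 0 ∨ j = 1) ∧ i ≠ j ∧
    a i = u i ∧ a j ≤ u j ∧ f u j ≤ u j ∧ a j ≤ f a j

/-- Knaster–Tarski on a box, for the coordinates in `S` only: a map that is monotone on `[a, b]`
and points inwards at both corners in every coordinate of `S` fixes these coordinates at some
point. -/
theorem exists_fixed_coordinates {ι : Type*} [Finite ι] (S : Set ι)
    {f : (ι → ℕ) → (ι → ℕ)} {a b : ι → ℕ} (hab : a ≤ b)
    (hmono : MonotoneOn f (Set.Icc a b))
    (ha : ∀ m ∈ S, a m ≤ f a m) (hb : ∀ m ∈ S, f b m ≤ b m) :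
    ∃ x ∈ Set.Icc a b, ∀ m ∈ S, f x m = x m := by
  classical
  cases nonempty_fintype ι
  obtain ⟨x, ⟨hx, hxf⟩, hmax⟩ :=
    ((Set.finite_Icc a b).subset (Set.sep_subset _ fun x => ∀ m ∈ S, x m ≤ f x m)).exists_maximal
      ⟨a, ⟨le_rfl, hab⟩, ha⟩
  refine ⟨x, hx, ?_⟩
  let y : ι → ℕ := fun m => if m ∈ S then f x m else x m
  have hxy : x ≤ y := by
    intro m
    by_cases hm : m ∈ S
    · simpa [y, hm] using hxf m hm
    · simp [y, hm]
  have hyb : y ≤ b := by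
    intro m
    by_cases hm : m ∈ S
    · simpa [y, hm] using (hmono hx ⟨hab, le_rfl⟩ hx.2 m).trans (hb m hm)
    · simpa [y, hm] using hx.2 m
  have hy : y ∈ Set.Icc a b := ⟨hx.1.trans hxy, hyb⟩
  have hyx : y ≤ x := hmax ⟨hy, fun m hm => by
    simpa [y, hm] using hmono hx hy hxy m⟩ hxy
  intro m hm
  exact le_antisymm (by simpa [y, hm] using hyx m) (hxf m hm)

theorem DownSetWitness.le {f : (Fin 3 → ℕ) → (Fin 3 → ℕ)} {d b : Fin 3 → ℕ}
    (h : DownSetWitness f d b) : d ≤ b := by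
  obtain ⟨h2, -, -, i, j, hi, hj, hij, hdi, hdj, -, -⟩ := h
  intro m
  obtain rfl | rfl | rfl : m = i ∨ m = j ∨ m = 2 := by omega
  exacts [hdi.le, hdj, h2.le]

theorem UpSetWitness.le {f : (Fin 3 → ℕ) → (Fin 3 → ℕ)} {a u : Fin 3 → ℕ}
    (h : UpSetWitness f a u) : a ≤ u := by
  obtain ⟨h2, -, -, i, j, hi, hj, hij, hai, haj, -, -⟩ := h
  intro m
  obtain rfl | rfl | rfl : m = i ∨ m = j ∨ m = 2 := by omega
  exacts [hai.le, haj, h2.le]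

/-- Between the points of a down set witness there is a point of `Up(f)`, or a point at which `f`
decreases both free coordinates of the slice. -/
theorem DownSetWitness.exists_le_or_slice_down {f : (Fin 3 → ℕ) → (Fin 3 → ℕ)}
    {d b : Fin 3 → ℕ} (h : DownSetWitness f d b) (hmono : MonotoneOn f (Set.Icc d b)) :
    ∃ x ∈ Set.Icc d b, x ≤ f x ∨ f x 0 ≤ x 0 ∧ f x 1 ≤ x 1 := by
  have hdb := h.le
  obtain ⟨h2, hd2, -, i, j, hi, hj, hij, -, -, hdj, hbj⟩ := h
  have hcover : ∀ m, m = i ∨ m = j ∨ m = 2 := by omega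
  obtain ⟨x, hx, hxj⟩ := exists_fixed_coordinates {j} hdb hmono
    (by simpa using hdj) (by simpa using hbj)
  have hxj : f x j = x j := hxj j rfl
  refine ⟨x, hx, ?_⟩
  by_cases hxi : x i ≤ f x i
  · left
    intro m
    obtain rfl | rfl | rfl := hcover m
    exacts [hxi, hxj.ge,
      (hx.2 2).trans (h2.ge.trans (hd2.trans (hmono ⟨le_rfl, hdb⟩ hx hx.1 2)))]
  · right
    have hle : ∀ m, m = 0 ∨ m = 1 → f x m ≤ x m := by
      intro m hm
      obtain rfl | rfl | rfl := hcover m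
      · exact (not_le.mp hxi).le
      · exact hxj.le
      · omega
    exact ⟨hle 0 (.inl rfl), hle 1 (.inr rfl)⟩

/-- Between the points of an up set witness there is a point of `Down(f)`, or a point at which `f`
increases both free coordinates of the slice. -/
theorem UpSetWitness.exists_ge_or_slice_up {f : (Fin 3 → ℕ) → (Fin 3 → ℕ)}
    {a u : Fin 3 → ℕ} (h : UpSetWitness f a u) (hmono : MonotoneOn f (Set.Icc a u)) :
    ∃ x ∈ Set.Icc a u, f x ≤ x ∨ x 0 ≤ f x 0 ∧ x 1 ≤ f x 1 := by
  have hau := h.le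
  obtain ⟨h2, -, hu2, i, j, hi, hj, hij, -, -, huj, haj⟩ := h
  have hcover : ∀ m, m = i ∨ m = j ∨ m = 2 := by omega
  obtain ⟨x, hx, hxj⟩ := exists_fixed_coordinates {j} hau hmono
    (by simpa using haj) (by simpa using huj)
  have hxj : f x j = x j := hxj j rfl
  refine ⟨x, hx, ?_⟩
  by_cases hxi : f x i ≤ x i
  · left
    intro m
    obtain rfl | rfl | rfl := hcover m
    exacts [hxi, hxj.le,
      (hmono hx ⟨hau, le_rfl⟩ hx.2 2).trans (hu2.trans (h2.ge.trans (hx.1 2)))]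
  · right
    have hge : ∀ m, m = 0 ∨ m = 1 → x m ≤ f x m := by
      intro m hm
      obtain rfl | rfl | rfl := hcover m
      · exact (not_le.mp hxi).le
      · exact hxj.ge
      · omega
    exact ⟨hge 0 (.inl rfl), hge 1 (.inr rfl)⟩

/-- A monotone map on a box that points inwards at both corners, in the first two
coordinates, has a point of `Up(f) ∪ Down(f)` there. -/
theorem exists_le_or_ge_of_inward_corners {f : (Fin 3 → ℕ) → (Fin 3 → ℕ)} {a b : Fin 3 → ℕ}
    (hab : a ≤ b) (hmono : MonotoneOn f (Set.Icc a b))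
    (ha : a 0 ≤ f a 0 ∧ a 1 ≤ f a 1) (hb : f b 0 ≤ b 0 ∧ f b 1 ≤ b 1) :
    ∃ x ∈ Set.Icc a b, x ≤ f x ∨ f x ≤ x := by
  obtain ⟨x, hx, hfix⟩ := exists_fixed_coordinates {0, 1} hab hmono
    (by simpa using ha) (by simpa using hb)
  have h0 : f x 0 = x 0 := hfix 0 (by simp)
  have h1 : f x 1 = x 1 := hfix 1 (by simp)
  refine ⟨x, hx, (le_total (x 2) (f x 2)).imp ?_ ?_⟩ <;>
    simp [Pi.le_def, Fin.forall_fin_succ, h0, h1]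

/-- **Lemma (the inner algorithm invariant yields a solution).**
If `L_{a,b}` (a sub-instance of the slice fixing dimension 3) satisfies the inner
algorithm invariant, then it contains either a point of `Up(f) ∪ Down(f)`, or a
pair of points violating order preservation of `f`. -/
theorem invariant_solution (n : Fin 3 → ℕ)
    (f : (Fin 3 → ℕ) → (Fin 3 → ℕ))
    (hf : ∀ x, (∀ m, 1 ≤ x m ∧ x m ≤ n m) → ∀ m, 1 ≤ f x m ∧ f x m ≤ n m)
    (a b : Fin 3 → ℕ)
    (ha : ∀ m, 1 ≤ a m ∧ a m ≤ n m) (hb : ∀ m, 1 ≤ b m ∧ b m ≤ n m)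
    (hab : ∀ m, a m ≤ b m) (hab3 : a 2 = b 2)
    (hinv :
      ((a 0 ≤ f a 0 ∧ a 1 ≤ f a 1) ∧ (f b 0 ≤ b 0 ∧ f b 1 ≤ b 1)) ∨
      ((a 0 ≤ f a 0 ∧ a 1 ≤ f a 1) ∧
        (∃ d, (∀ m, a m ≤ d m) ∧ DownSetWitness f d b)) ∨
      ((∃ u, (∀ m, u m ≤ b m) ∧ UpSetWitness f a u) ∧
        (f b 0 ≤ b 0 ∧ f b 1 ≤ b 1)) ∨
      (∃ u d, UpSetWitness f a u ∧ DownSetWitness f d b ∧ (∀ m, u m ≤ d m))) :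
    (∃ x, (∀ m, a m ≤ x m) ∧ (∀ m, x m ≤ b m) ∧
      ((∀ m, x m ≤ f x m) ∨ (∀ m, f x m ≤ x m))) ∨
    (∃ x y, (∀ m, a m ≤ x m) ∧ (∀ m, x m ≤ y m) ∧ (∀ m, y m ≤ b m) ∧
      ¬ (∀ m, f x m ≤ f y m)) := by
  by_contra hcon
  simp only [not_or, not_exists, not_and, not_not] at hcon
  obtain ⟨hsol, hmon⟩ := hcon
  have hno : ∀ x ∈ Set.Icc a b, ¬ x ≤ f x ∧ ¬ f x ≤ x := fun x hx => by
    simpa only [not_forall, Pi.le_def] using hsol x hx.1 hx.2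
  have hmono : MonotoneOn f (Set.Icc a b) := fun x hx y hy hxy => hmon x y hx.1 hxy hy.2
  have hcorners : ∀ x ∈ Set.Icc a b, ∀ y ∈ Set.Icc a b, x ≤ y →
      x 0 ≤ f x 0 ∧ x 1 ≤ f x 1 → f y 0 ≤ y 0 ∧ f y 1 ≤ y 1 → False := by
    intro x hx y hy hxy hxf hyf
    have hsub : Set.Icc x y ⊆ Set.Icc a b := Set.Icc_subset_Icc hx.1 hy.2
    obtain ⟨z, hz, hzf⟩ :=
      exists_le_or_ge_of_inward_corners hxy (hmono.mono hsub) hxf hyf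
    exact hzf.elim (hno z (hsub hz)).1 (hno z (hsub hz)).2
  have hdown : ∀ d, a ≤ d → DownSetWitness f d b →
      ∃ y ∈ Set.Icc a b, d ≤ y ∧ f y 0 ≤ y 0 ∧ f y 1 ≤ y 1 := by
    intro d had hd
    have hsub : Set.Icc d b ⊆ Set.Icc a b := Set.Icc_subset_Icc_left had
    obtain ⟨y, hy, hyf⟩ := hd.exists_le_or_slice_down (hmono.mono hsub)
    exact ⟨y, hsub hy, hy.1, hyf.resolve_left (hno y (hsub hy)).1⟩
  have hup : ∀ u, u ≤ b → UpSetWitness f a u →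
      ∃ x ∈ Set.Icc a b, x ≤ u ∧ x 0 ≤ f x 0 ∧ x 1 ≤ f x 1 := by
    intro u hub hu
    have hsub : Set.Icc a u ⊆ Set.Icc a b := Set.Icc_subset_Icc_right hub
    obtain ⟨x, hx, hxf⟩ := hu.exists_ge_or_slice_up (hmono.mono hsub)
    exact ⟨x, hsub hx, hx.2, hxf.resolve_left (hno x (hsub hx)).2⟩
  have haI : a ∈ Set.Icc a b := ⟨le_rfl, hab⟩
  have hbI : b ∈ Set.Icc a b := ⟨hab, le_rfl⟩
  rcases hinv with ⟨haf, hbf⟩ | ⟨haf, d, had, hd⟩ | ⟨⟨u, hub, hu⟩, hbf⟩ | ⟨u, d, hu, hd, hud⟩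
  · exact hcorners a haI b hbI hab haf hbf
  · obtain ⟨y, hy, -, hyf⟩ := hdown d had hd
    exact hcorners a haI y hy hy.1 haf hyf
  · obtain ⟨x, hx, -, hxf⟩ := hup u hub hu
    exact hcorners x hx b hbI hx.2 hxf hbf
  · obtain ⟨x, hx, hxu, hxf⟩ := hup u (le_trans hud hd.le) hu
    obtain ⟨y, hy, hdy, hyf⟩ := hdown d (hu.le.trans hud) hd
    exact hcorners x hx y hy (hxu.trans (le_trans hud hdy)) hxf hyf
end

section
/- Let L = L(n₁,n₂,n₃) ⊂ ℕ³, let f : L → L, and let (d, b) be a down set witness: d₃ = b₃, d₃ ≤ f(d)₃, b₃ ≤ f(b)₃, and there are distinct i, j ∈ {1,2} with d_i = b_i, d_j ≤ b_j, d_j ≤ f(d)_j, and f(b)_j ≤ b_j. Then at least one of the following exists: a point x with d ⪯ x ⪯ b and f(x)_j = x_j; or two points x, y with d ⪯ x ⪯ y ⪯ b and ¬(f(x) ⪯ f(y)). -/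
/-- Discrete intermediate value property: an integer function that starts weakly above the
identity and ends weakly below it either has a fixed point or decreases at some step. -/
theorem exists_fixed_or_exists_succ_lt (g : ℕ → ℕ) {a c : ℕ} (hac : a ≤ c)
    (ha : a ≤ g a) (hc : g c ≤ c) :
    (∃ t, a ≤ t ∧ t ≤ c ∧ g t = t) ∨ ∃ t, a ≤ t ∧ t + 1 ≤ c ∧ g (t + 1) < g t := by
  by_contra! h
  obtain ⟨hfix, hstep⟩ := h
  have key : ∀ t, a ≤ t → t ≤ c → t < g t := by
    intro t hat
    induction t, hat using Nat.le_induction with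
    | base => exact fun htc => lt_of_le_of_ne ha (hfix a le_rfl htc).symm
    | succ t hat ih =>
      intro htc
      have h₁ := ih (by omega)
      have h₂ := hstep t hat htc
      have h₃ := hfix (t + 1) (by omega) htc
      omega
  exact absurd (key c hac le_rfl) hc.not_gt

/-- **Lemma (one-dimensional search along a down set witness).**
Given a down set witness `(d, b)` with free dimension `j`, between `d` and `b`
there is either a point `x` that is a fixed point of the one-dimensional slice
(`f(x)_j = x_j`), or a pair of points violating order preservation of `f`. -/
theorem down_set_witness_onedim (n : Fin 3 → ℕ)
    (f : (Fin 3 → ℕ) → (Fin 3 → ℕ))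
    (hf : ∀ x, (∀ m, 1 ≤ x m ∧ x m ≤ n m) → ∀ m, 1 ≤ f x m ∧ f x m ≤ n m)
    (d b : Fin 3 → ℕ)
    (hd : ∀ m, 1 ≤ d m ∧ d m ≤ n m) (hb : ∀ m, 1 ≤ b m ∧ b m ≤ n m)
    (i j : Fin 3) (hi : i = 0 ∨ i = 1) (hj : j = 0 ∨ j = 1) (hij : i ≠ j)
    (h3 : d 2 = b 2) (hd3 : d 2 ≤ f d 2) (hb3 : b 2 ≤ f b 2)
    (hdbi : d i = b i) (hdbj : d j ≤ b j) (hdj : d j ≤ f d j) (hbj : f b j ≤ b j) :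
    (∃ x, (∀ m, d m ≤ x m) ∧ (∀ m, x m ≤ b m) ∧ f x j = x j) ∨
    (∃ x y, (∀ m, d m ≤ x m) ∧ (∀ m, x m ≤ y m) ∧ (∀ m, y m ≤ b m) ∧
      ¬ (∀ m, f x m ≤ f y m)) := by
  have hb_eq : Function.update d j (b j) = b := by
    funext m
    by_cases hm : m = j
    · subst hm
      simp
    · rw [Function.update_of_ne hm]
      have : m = i ∨ m = 2 := by omega
      rcases this with rfl | rfl <;> assumption
  have hle {t : ℕ} (ht : d j ≤ t) : d ≤ Function.update d j t :=
    le_update_self_iff.2 ht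
  have hub {t : ℕ} (ht : t ≤ b j) : Function.update d j t ≤ b := by
    conv_rhs => rw [← hb_eq]
    exact update_le_update_iff'.2 ht
  rcases exists_fixed_or_exists_succ_lt (fun t => f (Function.update d j t) j) hdbj
    (by simpa using hdj) (by simpa [hb_eq] using hbj) with ⟨t, ht, htb, h⟩ | ⟨t, ht, htb, h⟩
  · exact Or.inl ⟨_, hle ht, hub htb, by simpa using h⟩
  · exact Or.inr ⟨_, _, hle ht, update_le_update_iff'.2 t.le_succ, hub htb,
      fun hmono => (hmono j).not_gt h⟩
end

section
/- Let L = L(n₁,n₂,n₃) ⊂ ℕ³, let f : L → L, and let (a, u) be an up set witness: a₃ = u₃, a₃ ≥ f(a)₃, u₃ ≥ f(u)₃, and there are distinct i, j ∈ {1,2} with a_i = u_i, u_j ≥ a_j, u_j ≥ f(u)_j, and f(a)_j ≥ a_j. Then at least one of the following exists: a point x with a ⪯ x ⪯ u and f(x)_j = x_j; or two points x, y with a ⪯ x ⪯ y ⪯ u and ¬(f(x) ⪯ f(y)). -/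
/-- A monotone map on a nonempty interval of natural numbers that moves the left end weakly up and
the right end weakly down has a fixed point in the interval. -/
theorem Nat.exists_fixed_of_monotoneOn_Icc {g : ℕ → ℕ} {p q : ℕ} (hpq : p ≤ q)
    (hg : MonotoneOn g (Set.Icc p q)) (hp : p ≤ g p) (hq : g q ≤ q) :
    ∃ k ∈ Set.Icc p q, g k = k := by
  by_contra! hne
  have le_apply : ∀ k, p ≤ k → k ≤ q → k ≤ g k := by
    intro k hk
    induction k, hk using Nat.le_induction with
    | base => exact fun _ => hp
    | succ k hk ih =>
      intro hkq
      have hk' : k ∈ Set.Icc p q := ⟨hk, by omega⟩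
      have hstep := hg hk' ⟨by omega, hkq⟩ k.le_succ
      have hlow := ih hk'.2
      have hmove := hne k hk'
      omega
  exact hne q ⟨hpq, le_rfl⟩ (hq.antisymm (le_apply q hpq le_rfl))

/-- **Lemma (one-dimensional search along an up set witness).**
Given an up set witness `(a, u)` with free dimension `j`, between `a` and `u`
there is either a point `x` that is a fixed point of the one-dimensional slice
(`f(x)_j = x_j`), or a pair of points violating order preservation of `f`. -/
theorem up_set_witness_onedim (n : Fin 3 → ℕ)
    (f : (Fin 3 → ℕ) → (Fin 3 → ℕ))
    (hf : ∀ x, (∀ m, 1 ≤ x m ∧ x m ≤ n m) → ∀ m, 1 ≤ f x m ∧ f x m ≤ n m)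
    (a u : Fin 3 → ℕ)
    (ha : ∀ m, 1 ≤ a m ∧ a m ≤ n m) (hu : ∀ m, 1 ≤ u m ∧ u m ≤ n m)
    (i j : Fin 3) (hi : i = 0 ∨ i = 1) (hj : j = 0 ∨ j = 1) (hij : i ≠ j)
    (h3 : a 2 = u 2) (ha3 : f a 2 ≤ a 2) (hu3 : f u 2 ≤ u 2)
    (haui : a i = u i) (hauj : a j ≤ u j) (huj : f u j ≤ u j) (haj : a j ≤ f a j) :
    (∃ x, (∀ m, a m ≤ x m) ∧ (∀ m, x m ≤ u m) ∧ f x j = x j) ∨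
    (∃ x y, (∀ m, a m ≤ x m) ∧ (∀ m, x m ≤ y m) ∧ (∀ m, y m ≤ u m) ∧
      ¬ (∀ m, f x m ≤ f y m)) := by
  have hend : Function.update a j (u j) = u := by
    refine Function.update_eq_iff.2 ⟨rfl, fun m hm => ?_⟩
    obtain rfl | rfl : m = i ∨ m = 2 := by omega
    exacts [haui, h3]
  have lower : ∀ k ∈ Set.Icc (a j) (u j), a ≤ Function.update a j k :=
    fun k hk => le_update_iff.2 ⟨hk.1, fun _ _ => le_rfl⟩
  have upper : ∀ k ∈ Set.Icc (a j) (u j), Function.update a j k ≤ u := fun k hk => by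
    rw [← hend]
    exact Function.update_mono hk.2
  refine or_iff_not_imp_right.2 fun hmono => ?_
  push Not at hmono
  obtain ⟨k, hk, hfix⟩ := Nat.exists_fixed_of_monotoneOn_Icc
    (g := fun k => f (Function.update a j k) j) hauj
    (fun k hk l hl hkl => hmono _ _ (lower k hk) (Function.update_mono (i := j) hkl) (upper l hl) j)
    (by simpa using haj) (by simpa [hend] using huj)
  exact ⟨_, lower k hk, upper k hk, by simpa using hfix⟩
end

section
/- Let L = L(n₁,n₂,n₃) ⊂ ℕ³, let f : L → L, and let (d, b) be a down set witness whose fixed free dimension is i, i.e. d₃ = b₃, d₃ ≤ f(d)₃, b₃ ≤ f(b)₃, and for distinct i, j ∈ {1,2}: d_i = b_i, d_j ≤ b_j, d_j ≤ f(d)_j, and f(b)_j ≤ b_j. Let p ∈ L satisfy p ⪯ d, p_i = b_i, p₃ = b₃, and p_i < f(p)_i. Then at least one of the following exists: a point x with p ⪯ x ⪯ b and x ⪯ f(x); or two points x, y with p ⪯ x ⪯ y ⪯ b and ¬(f(x) ⪯ f(y)). -/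
/-- **Lemma (special case for down set witnesses).**
Let `(d, b)` be a down set witness whose fixed free dimension is `i`, and let `p`
be a point of the slice with `p ⪯ d`, `p_i = b_i`, `p₃ = b₃`, and `p_i < f(p)_i`.
Then between `p` and `b` there is either a point of the up set of `f`, or a pair
of points violating order preservation of `f`. -/
theorem down_set_witness_special (n : Fin 3 → ℕ)
    (f : (Fin 3 → ℕ) → (Fin 3 → ℕ))
    (hf : ∀ x, (∀ m, 1 ≤ x m ∧ x m ≤ n m) → ∀ m, 1 ≤ f x m ∧ f x m ≤ n m)
    (d b : Fin 3 → ℕ)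
    (hd : ∀ m, 1 ≤ d m ∧ d m ≤ n m) (hb : ∀ m, 1 ≤ b m ∧ b m ≤ n m)
    (i j : Fin 3) (hi : i = 0 ∨ i = 1) (hj : j = 0 ∨ j = 1) (hij : i ≠ j)
    (h3 : d 2 = b 2) (hd3 : d 2 ≤ f d 2) (hb3 : b 2 ≤ f b 2)
    (hdbi : d i = b i) (hdbj : d j ≤ b j) (hdj : d j ≤ f d j) (hbj : f b j ≤ b j)
    (p : Fin 3 → ℕ) (hp : ∀ m, 1 ≤ p m ∧ p m ≤ n m)
    (hpd : ∀ m, p m ≤ d m) (hpi : p i = b i) (hp3 : p 2 = b 2)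
    (hpf : p i < f p i) :
    (∃ x, (∀ m, p m ≤ x m) ∧ (∀ m, x m ≤ b m) ∧ (∀ m, x m ≤ f x m)) ∨
    (∃ x y, (∀ m, p m ≤ x m) ∧ (∀ m, x m ≤ y m) ∧ (∀ m, y m ≤ b m) ∧
      ¬ (∀ m, f x m ≤ f y m)) := by
  have hcases : ∀ m : Fin 3, m = i ∨ m = j ∨ m = 2 := by
    intro m
    rcases hi with rfl | rfl <;> rcases hj with rfl | rfl <;> fin_cases m <;> simp_all
  have hdb : ∀ m, d m ≤ b m := by
    intro m
    rcases hcases m with rfl | rfl | rfl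
    exacts [hdbi.le, hdbj, h3.le]
  by_cases hmono : ∀ m, f p m ≤ f d m
  · refine Or.inl ⟨d, hpd, hdb, fun m => ?_⟩
    rcases hcases m with rfl | rfl | rfl
    · exact (hdbi.trans hpi.symm).le.trans (hpf.le.trans (hmono _))
    · exact hdj
    · exact hd3
  · exact Or.inr ⟨p, d, fun _ => le_rfl, hpd, hdb, hmono⟩
end

section
/- Let L = L(n₁,n₂,n₃) ⊂ ℕ³, let f : L → L, and let (a, u) be an up set witness whose fixed free dimension is i, i.e. a₃ = u₃, a₃ ≥ f(a)₃, u₃ ≥ f(u)₃, and for distinct i, j ∈ {1,2}: a_i = u_i, u_j ≥ a_j, u_j ≥ f(u)_j, and f(a)_j ≥ a_j. Let p ∈ L satisfy u ⪯ p, p_i = a_i, p₃ = a₃, and p_i > f(p)_i. Then at least one of the following exists: a point x with a ⪯ x ⪯ p and f(x) ⪯ x; or two points x, y with a ⪯ x ⪯ y ⪯ p and ¬(f(x) ⪯ f(y)). -/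
/-- **Lemma (special case for up set witnesses).**
Let `(a, u)` be an up set witness whose fixed free dimension is `i`, and let `p`
be a point of the slice with `u ⪯ p`, `p_i = a_i`, `p₃ = a₃`, and `p_i > f(p)_i`.
Then between `a` and `p` there is either a point of the down set of `f`, or a
pair of points violating order preservation of `f`. -/
theorem up_set_witness_special (n : Fin 3 → ℕ)
    (f : (Fin 3 → ℕ) → (Fin 3 → ℕ))
    (hf : ∀ x, (∀ m, 1 ≤ x m ∧ x m ≤ n m) → ∀ m, 1 ≤ f x m ∧ f x m ≤ n m)
    (a u : Fin 3 → ℕ)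
    (ha : ∀ m, 1 ≤ a m ∧ a m ≤ n m) (hu : ∀ m, 1 ≤ u m ∧ u m ≤ n m)
    (i j : Fin 3) (hi : i = 0 ∨ i = 1) (hj : j = 0 ∨ j = 1) (hij : i ≠ j)
    (h3 : a 2 = u 2) (ha3 : f a 2 ≤ a 2) (hu3 : f u 2 ≤ u 2)
    (haui : a i = u i) (hauj : a j ≤ u j) (huj : f u j ≤ u j) (haj : a j ≤ f a j)
    (p : Fin 3 → ℕ) (hp : ∀ m, 1 ≤ p m ∧ p m ≤ n m)
    (hup : ∀ m, u m ≤ p m) (hpi : p i = a i) (hp3 : p 2 = a 2)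
    (hpf : f p i < p i) :
    (∃ x, (∀ m, a m ≤ x m) ∧ (∀ m, x m ≤ p m) ∧ (∀ m, f x m ≤ x m)) ∨
    (∃ x y, (∀ m, a m ≤ x m) ∧ (∀ m, x m ≤ y m) ∧ (∀ m, y m ≤ p m) ∧
      ¬ (∀ m, f x m ≤ f y m)) := by
  have hau : ∀ m, a m ≤ u m := by
    rcases hi with rfl | rfl <;> rcases hj with rfl | rfl <;>
      simp_all [Fin.forall_fin_succ]
  by_cases h : ∀ m, f u m ≤ f p m
  · refine Or.inl ⟨u, hau, hup, ?_⟩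
    have hui : f u i ≤ u i := by
      have := h i
      omega
    rcases hi with rfl | rfl <;> rcases hj with rfl | rfl <;>
      simp_all [Fin.forall_fin_succ]
  · exact Or.inr ⟨u, p, hau, hup, fun _ => le_rfl, h⟩
end

section
/- Let L = L(n₁,n₂,n₃) ⊂ ℕ³, let f : L → L, and let x, y ∈ L satisfy x ⪯ y, x ⪯ f(x), and f(y) ⪯ y. Let c be a value with x₃ ≤ c ≤ y₃, and define a = (x₁, x₂, c) and b = (y₁, y₂, c). Then both of the following hold: (i) either (a₁ ≤ f(a)₁ and a₂ ≤ f(a)₂), or the pair (x, a) is a violation of order preservation of f (i.e. x ⪯ a and ¬(f(x) ⪯ f(a))); and (ii) either (f(b)₁ ≤ b₁ and f(b)₂ ≤ b₂), or the pair (b, y) is a violation of order preservation of f (i.e. b ⪯ y and ¬(f(b) ⪯ f(y))). -/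
/-- **Lemma (initialization of the inner algorithm).**
Let `x ⪯ y` with `x ∈ Up(f)` and `y ∈ Down(f)`, and let `a`, `b` be the
projections of `x`, `y` onto the slice fixing dimension 3 at value `c` (with
`x₃ ≤ c ≤ y₃`). Then (i) either `a` is in the up set of the restricted function
`f_s`, or `(x, a)` violates order preservation of `f`; and (ii) either `b` is in
the down set of `f_s`, or `(b, y)` violates order preservation of `f`. -/
theorem inner_init (n : Fin 3 → ℕ)
    (f : (Fin 3 → ℕ) → (Fin 3 → ℕ))
    (hf : ∀ z, (∀ m, 1 ≤ z m ∧ z m ≤ n m) → ∀ m, 1 ≤ f z m ∧ f z m ≤ n m)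
    (x y : Fin 3 → ℕ)
    (hx : ∀ m, 1 ≤ x m ∧ x m ≤ n m) (hy : ∀ m, 1 ≤ y m ∧ y m ≤ n m)
    (hxy : ∀ m, x m ≤ y m)
    (hxup : ∀ m, x m ≤ f x m) (hydown : ∀ m, f y m ≤ y m)
    (c : ℕ) (hc1 : x 2 ≤ c) (hc2 : c ≤ y 2)
    (a b : Fin 3 → ℕ)
    (hadef : a = Function.update x 2 c) (hbdef : b = Function.update y 2 c) :
    ((a 0 ≤ f a 0 ∧ a 1 ≤ f a 1) ∨
      ((∀ m, x m ≤ a m) ∧ ¬ (∀ m, f x m ≤ f a m))) ∧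
    ((f b 0 ≤ b 0 ∧ f b 1 ≤ b 1) ∨
      ((∀ m, b m ≤ y m) ∧ ¬ (∀ m, f b m ≤ f y m))) := by
  have ha0 : a 0 = x 0 := by simp [hadef]
  have ha1 : a 1 = x 1 := by simp [hadef]
  have ha2 : a 2 = c := by simp [hadef]
  have hb0 : b 0 = y 0 := by simp [hbdef]
  have hb1 : b 1 = y 1 := by simp [hbdef]
  have hb2 : b 2 = c := by simp [hbdef]
  constructor
  · by_cases h : ∀ m, f x m ≤ f a m
    · exact Or.inl ⟨ha0.trans_le ((hxup 0).trans (h 0)), ha1.trans_le ((hxup 1).trans (h 1))⟩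
    · exact Or.inr ⟨Fin.forall_fin_succ.2 ⟨ha0.ge, Fin.forall_fin_two.2 ⟨ha1.ge, hc1.trans_eq ha2.symm⟩⟩, h⟩
  · by_cases h : ∀ m, f b m ≤ f y m
    · exact Or.inl ⟨((h 0).trans (hydown 0)).trans_eq hb0.symm,
        ((h 1).trans (hydown 1)).trans_eq hb1.symm⟩
    · exact Or.inr ⟨Fin.forall_fin_succ.2 ⟨hb0.le, Fin.forall_fin_two.2 ⟨hb1.le, hb2.trans_le hc2⟩⟩, h⟩
end

section
/- Let L = L(n₁,n₂,n₃) ⊂ ℕ³, let f : L → L, and let a, b ∈ L satisfy a ⪯ b, a ⪯ f(a), and f(b) ⪯ b. Let c be a value with a₃ ≤ c ≤ b₃. Then at least one of the following exists: a point x with a ⪯ x ⪯ b and x₃ = c such that x ⪯ f(x) or f(x) ⪯ x; or two points x, y with a ⪯ x ⪯ y ⪯ b and ¬(f(x) ⪯ f(y)). (This is the existential content of the correctness of the inner algorithm for three-dimensional Tarski instances.) -/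
/-- A monotone self-map of a finite set which moves some point of the set up
has a fixed point in the set. -/
theorem exists_fixed_point_of_finite_of_monotoneOn {α : Type*} [PartialOrder α] {s : Set α}
    (hs : s.Finite) {g : α → α} (hg : MonotoneOn g s) (hmaps : Set.MapsTo g s s)
    {x₀ : α} (hx₀ : x₀ ∈ s) (hle : x₀ ≤ g x₀) : ∃ x ∈ s, g x = x := by
  obtain ⟨x, hx⟩ := (hs.subset (Set.sep_subset s fun x => x ≤ g x)).exists_maximal ⟨x₀, hx₀, hle⟩
  obtain ⟨hxs, hxg⟩ := hx.prop
  exact ⟨x, hxs, (hx.eq_of_le ⟨hmaps hxs, hg hxs (hmaps hxs) hxg⟩ hxg).symm⟩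


/-- **Correctness of the inner algorithm (existential content).**
Let `a ⪯ b` be points of a three-dimensional Tarski instance with `a ∈ Up(f)` and
`b ∈ Down(f)`, and let `c` be a value with `a₃ ≤ c ≤ b₃` determining a principle
slice of the sub-instance `L_{a,b}`. Then there exists either a point of that
slice within `L_{a,b}` lying in `Up(f)` or `Down(f)`, or a pair of points in
`L_{a,b}` witnessing a violation of order preservation of `f`. -/
theorem inner_algorithm_correct (n : Fin 3 → ℕ)
    (f : (Fin 3 → ℕ) → (Fin 3 → ℕ))
    (hf : ∀ z, (∀ m, 1 ≤ z m ∧ z m ≤ n m) → ∀ m, 1 ≤ f z m ∧ f z m ≤ n m)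
    (a b : Fin 3 → ℕ)
    (ha : ∀ m, 1 ≤ a m ∧ a m ≤ n m) (hb : ∀ m, 1 ≤ b m ∧ b m ≤ n m)
    (hab : ∀ m, a m ≤ b m)
    (haup : ∀ m, a m ≤ f a m) (hbdown : ∀ m, f b m ≤ b m)
    (c : ℕ) (hc1 : a 2 ≤ c) (hc2 : c ≤ b 2) :
    (∃ x, (∀ m, a m ≤ x m) ∧ (∀ m, x m ≤ b m) ∧ x 2 = c ∧
      ((∀ m, x m ≤ f x m) ∨ (∀ m, f x m ≤ x m))) ∨
    (∃ x y, (∀ m, a m ≤ x m) ∧ (∀ m, x m ≤ y m) ∧ (∀ m, y m ≤ b m) ∧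
      ¬ (∀ m, f x m ≤ f y m)) := by
  by_contra! hno
  obtain ⟨hslice, hviol⟩ := hno
  have hmono : ∀ x y, a ≤ x → x ≤ y → y ≤ b → f x ≤ f y := hviol
  have hlow : ∀ x, a ≤ x → x ≤ b → a ≤ f x := fun x hax hxb =>
    le_trans haup (hmono a x le_rfl hax hxb)
  have hupp : ∀ x, a ≤ x → x ≤ b → f x ≤ b := fun x hax hxb =>
    le_trans (hmono x b hax hxb le_rfl) hbdown
  let s : Set (Fin 3 → ℕ) := {x | x ∈ Set.Icc a b ∧ x 2 = c}
  have hs : s.Finite := (Set.finite_Icc a b).subset fun x hx => hx.1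
  have hupdate : ∀ z, a ≤ z → z ≤ b → Function.update z 2 c ∈ s := fun z haz hzb =>
    ⟨⟨le_update_iff.2 ⟨hc1, fun m _ => haz m⟩, update_le_iff.2 ⟨hc2, fun m _ => hzb m⟩⟩,
      Function.update_self ..⟩
  have hstart : Function.update a 2 c ∈ s := hupdate a le_rfl hab
  obtain ⟨x, ⟨⟨hax, hxb⟩, hxc⟩, hfix⟩ :=
    exists_fixed_point_of_finite_of_monotoneOn hs (g := fun x => Function.update (f x) 2 c)
      (fun x hx y hy hxy => update_le_update_iff.2
        ⟨le_rfl, fun m _ => hmono x y hx.1.1 hxy hy.1.2 m⟩)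
      (fun x hx => hupdate _ (hlow x hx.1.1 hx.1.2) (hupp x hx.1.1 hx.1.2))
      hstart (update_le_update_iff.2
        ⟨le_rfl, fun m _ => hlow _ hstart.1.1 hstart.1.2 m⟩)
  have hother : ∀ m, m ≠ 2 → f x m = x m := fun m hm => by
    simpa [Function.update_of_ne hm] using congrFun hfix m
  obtain ⟨⟨i, hi⟩, ⟨j, hj⟩⟩ := hslice x hax hxb hxc
  have hi2 : i = 2 := by
    by_contra h
    exact hi.ne (hother i h)
  have hj2 : j = 2 := by
    by_contra h
    exact hj.ne (hother j h).symm
  subst hi2 hj2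
  exact lt_asymm hi hj
end
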